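/- arXiv:math/9906163 — 2 statements merged into one kernel-verified Lean document; each statement's English description precedes it below -/
import Mathlib

section
/- Let Y and Z be real normed vector spaces, j : Y → Z a continuous linear map with dense range, W a closed linear subspace of Z, and V := j⁻¹(W) its preimage in Y. If V has finite codimension in Y (i.e. the quotient vector space Y / V is finite-dimensional), then W has finite codimension in Z (i.e. Z / W is finite-dimensional). Equivalently, if W has infinite codimension in Z then V has infinite codimension in Y. -/
/-- abstract content of Lemma 3.10: Let `j : Y → Z` be a continuous
linear map between real normed spaces with dense range, `W` a closed subspace of `Z` and
`V := j⁻¹(W)`. If `V` has finite codimension in `Y`, then `W` has finite codimension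
in `Z`. -/
theorem finiteCodim_of_comap_finiteCodim
    (Y Z : Type*)
    [NormedAddCommGroup Y] [NormedSpace ℝ Y]
    [NormedAddCommGroup Z] [NormedSpace ℝ Z]
    (j : Y →L[ℝ] Z) (hdense : DenseRange j)
    (W : Submodule ℝ Z) (hW : IsClosed (W : Set Z))
    (hV : FiniteDimensional ℝ (Y ⧸ W.comap (j : Y →ₗ[ℝ] Z))) :
    FiniteDimensional ℝ (Z ⧸ W) := by
  haveI : IsClosed (W : Set Z) := hW
  let φ : (Y ⧸ W.comap (j : Y →ₗ[ℝ] Z)) →ₗ[ℝ] (Z ⧸ W) :=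
    Submodule.mapQ _ W (j : Y →ₗ[ℝ] Z) le_rfl
  have hcl : IsClosed (LinearMap.range φ : Set (Z ⧸ W)) :=
    Submodule.closed_of_finiteDimensional _
  have hd : DenseRange (fun y => W.mkQ (j y)) :=
    (W.mkQ_surjective.denseRange).comp hdense W.isOpenQuotientMap_mkQ.continuous
  have hsurj : Function.Surjective φ := by
    intro z
    have hsub : Set.range (fun y => W.mkQ (j y)) ⊆ (LinearMap.range φ : Set (Z ⧸ W)) := by
      rintro _ ⟨y, rfl⟩
      exact ⟨Submodule.Quotient.mk y, rfl⟩
    exact closure_minimal hsub hcl (hd z)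
  exact Module.Finite.of_surjective φ hsurj
end

section
/- Let X and Y be real normed vector spaces, D : X → Y a continuous linear map, c > 0 a constant with ‖v‖ ≤ c·‖D v‖ for all v ∈ X, b : X × X → Y a continuous bilinear map, N a seminorm on X, and C₁ > 0 a constant such that both ‖b(u, v)‖ ≤ C₁·N(u)·‖v‖ and ‖b(u, v)‖ ≤ C₁·‖u‖·N(v) hold for all u, v ∈ X. If v₁, v₂ ∈ X satisfy D v₁ + b(v₁, v₁) = D v₂ + b(v₂, v₂) and c·C₁·(N(v₁) + N(v₂)) < 1, then v₁ = v₂. -/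
/-- Claim 2 in the proof of Theorem 4.14, abstract form: Let `D : X → Y`
be a continuous linear map between real normed spaces which is bounded below
(`‖v‖ ≤ c ‖D v‖`), and `b` a continuous bilinear map satisfying the mixed bounds
`‖b(u,v)‖ ≤ C₁ N(u) ‖v‖` and `‖b(u,v)‖ ≤ C₁ ‖u‖ N(v)` for a seminorm `N` on `X`. If
`v₁, v₂` satisfy `D v₁ + b(v₁,v₁) = D v₂ + b(v₂,v₂)` and `c C₁ (N v₁ + N v₂) < 1`, then
`v₁ = v₂`. -/
theorem uniqueness_of_small_solutions
    (X Y : Type*)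
    [NormedAddCommGroup X] [NormedSpace ℝ X]
    [NormedAddCommGroup Y] [NormedSpace ℝ Y]
    (D : X →L[ℝ] Y) (c : ℝ) (hc : 0 < c) (hD : ∀ v : X, ‖v‖ ≤ c * ‖D v‖)
    (b : X →L[ℝ] X →L[ℝ] Y) (N : Seminorm ℝ X)
    (C₁ : ℝ) (hC₁ : 0 < C₁)
    (hb : ∀ u v : X, ‖b u v‖ ≤ C₁ * N u * ‖v‖)
    (hb' : ∀ u v : X, ‖b u v‖ ≤ C₁ * ‖u‖ * N v)
    (v₁ v₂ : X)
    (heq : D v₁ + b v₁ v₁ = D v₂ + b v₂ v₂)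
    (hsmall : c * C₁ * (N v₁ + N v₂) < 1) :
    v₁ = v₂ := by
  have h1 : D (v₁ - v₂) = -(b v₁ (v₁ - v₂) + b (v₁ - v₂) v₂) := by
    have h : D v₁ = D v₂ + b v₂ v₂ - b v₁ v₁ := eq_sub_of_add_eq heq
    simp only [map_sub, ContinuousLinearMap.sub_apply, h]
    abel
  have h2 : ‖D (v₁ - v₂)‖ ≤ C₁ * N v₁ * ‖v₁ - v₂‖ + C₁ * ‖v₁ - v₂‖ * N v₂ := by
    rw [h1, norm_neg]
    exact (norm_add_le _ _).trans (add_le_add (hb _ _) (hb' _ _))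
  have h3 := (hD (v₁ - v₂)).trans (mul_le_mul_of_nonneg_left h2 hc.le)
  by_contra hne
  have hpos : 0 < ‖v₁ - v₂‖ := norm_pos_iff.mpr (sub_ne_zero.mpr hne)
  have h4 := mul_lt_mul_of_pos_right hsmall hpos
  linarith
end
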